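/- Let G be a finite non-cyclic group such that G has no ES-partition for any subgroup S of G, while every proper non-cyclic subgroup H of G has an ET-partition for some subgroup T of H. Then G is a Schmidt group, i.e. G is not nilpotent but every proper subgroup of G is nilpotent. -/

import Mathlib

/-- A strict `S`-partition of a group `G`: a finite collection of at least two proper
subgroups of `G` covering `G`, any two distinct members of which intersect exactly in `S`. -/
def IsStrictPartition {G : Type*} [Group G] (S : Subgroup G) (P : Finset (Subgroup G)) : Prop :=
  2 ≤ P.card ∧ (∀ H ∈ P, H ≠ ⊤) ∧ (∀ g : G, ∃ H ∈ P, g ∈ H) ∧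
    ∀ H ∈ P, ∀ K ∈ P, H ≠ K → H ⊓ K = S

/-- An `ES`-partition: a strict `S`-partition all of whose components have the same order. -/
def IsESPartition {G : Type*} [Group G] (S : Subgroup G) (P : Finset (Subgroup G)) : Prop :=
  IsStrictPartition S P ∧ ∀ H ∈ P, ∀ K ∈ P, Nat.card H = Nat.card K

/-- A finite group is not the union of the conjugates of a proper subgroup. -/
theorem Subgroup.exists_forall_conj_notMem {G : Type*} [Group G] [Finite G] {H : Subgroup G}
    (hH : H ≠ ⊤) : ∃ x : G, ∀ g : G, g⁻¹ * x * g ∉ H := by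
  by_contra! hcov
  let f : (G ⧸ H) × H → G := fun z => z.1.out * z.2 * z.1.out⁻¹
  have hf : Function.Surjective f := by
    intro x
    obtain ⟨g, hg⟩ := hcov x
    obtain ⟨h, hh⟩ := QuotientGroup.mk_out_eq_mul H g
    refine ⟨((g : G ⧸ H),
      ⟨h⁻¹ * (g⁻¹ * x * g) * h, H.mul_mem (H.mul_mem (H.inv_mem h.2) hg) h.2⟩), ?_⟩
    simp only [f, hh, mul_inv_rev]
    simp [mul_assoc]
  have hcard : Nat.card ((G ⧸ H) × H) = Nat.card G := by
    rw [Nat.card_prod, Subgroup.card_eq_card_quotient_mul_card_subgroup H]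
  have hinj : Function.Injective f :=
    ((Nat.bijective_iff_surjective_and_card f).2 ⟨hf, hcard⟩).1
  refine hH (Subgroup.index_eq_one.1 ?_)
  rw [Subgroup.index, Nat.card_eq_one_iff_unique]
  refine ⟨⟨fun a b => ?_⟩, ⟨((1 : G) : G ⧸ H)⟩⟩
  have : ((a, 1) : (G ⧸ H) × H) = (b, 1) := hinj (by simp [f])
  exact congrArg Prod.fst this

theorem IsPGroup.commute_of_isNilpotent {G : Type*} [Group G] [Finite G] [Group.IsNilpotent G]
    {p q : ℕ} [Fact p.Prime] [Fact q.Prime] (hpq : p ≠ q) {P Q : Subgroup G}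
    (hP : IsPGroup p P) (hQ : IsPGroup q Q) {a b : G} (ha : a ∈ P) (hb : b ∈ Q) :
    a * b = b * a := by
  obtain ⟨P', hP'⟩ := hP.exists_le_sylow
  obtain ⟨Q', hQ'⟩ := hQ.exists_le_sylow
  exact Subgroup.commute_of_normal_of_disjoint _ _ inferInstance inferInstance
    (IsPGroup.disjoint_of_ne p q hpq _ _ P'.2 Q'.2) a b (hP' ha) (hQ' hb)

theorem IsPGroup.commute_of_isNilpotent_of_le {G : Type*} [Group G] [Finite G]
    {K : Subgroup G} (hK : Group.IsNilpotent K)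
    {p q : ℕ} [Fact p.Prime] [Fact q.Prime] (hpq : p ≠ q) {P Q : Subgroup G}
    (hP : IsPGroup p P) (hQ : IsPGroup q Q) {a b : G} (ha : a ∈ P) (hb : b ∈ Q)
    (haK : a ∈ K) (hbK : b ∈ K) : a * b = b * a := by
  have := IsPGroup.commute_of_isNilpotent hpq
    (hP.comap_of_injective K.subtype K.subtype_injective)
    (hQ.comap_of_injective K.subtype K.subtype_injective)
    (a := ⟨a, haK⟩) (b := ⟨b, hbK⟩) ha hb
  exact congrArg Subtype.val this

theorem Sylow.normal_of_le_of_isNilpotent {G : Type*} [Group G] [Finite G] {p : ℕ}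
    [Fact p.Prime] (P : Sylow p G) {M : Subgroup G} [M.Normal] (hM : Group.IsNilpotent M)
    (hPM : (P : Subgroup G) ≤ M) : (P : Subgroup G).Normal := by
  have h1 : ((P.subtype hPM : Sylow p M) : Subgroup M).Normal := inferInstance
  have h2 := Sylow.characteristic_of_normal _ h1
  have h3 := ConjAct.normal_of_characteristic_of_normal (H := M) (K := (P.subtype hPM : Sylow p M))
  rwa [Sylow.coe_subtype, Subgroup.subgroupOf_map_subtype, inf_eq_left.2 hPM] at h3

theorem IsCoatom.map_conj {G : Type*} [Group G] {M : Subgroup G} (hM : IsCoatom M) (g : G) :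
    IsCoatom (M.map (MulAut.conj g).toMonoidHom) :=
  ((MulAut.conj g).mapSubgroup.isCoatom_iff M).2 hM

section MinimalNonnilpotent

variable {G : Type*} [Group G] [Finite G]

/-- In a finite simple group all of whose proper subgroups are nilpotent, distinct maximal
subgroups intersect trivially. -/
theorem IsCoatom.eq_of_inf_ne_bot [IsSimpleGroup G]
    (hn : ∀ H : Subgroup G, H ≠ ⊤ → Group.IsNilpotent H) {M L : Subgroup G} (hM : IsCoatom M)
    (hL : IsCoatom L) (h : M ⊓ L ≠ ⊥) : M = L := by
  obtain ⟨D, hD⟩ : ∃ D, M ⊓ L = D := ⟨_, rfl⟩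
  induction D using WellFoundedGT.induction generalizing M L with
  | ind D ih =>
    by_contra hne
    rw [hD] at h
    have hDtop : D ≠ ⊤ := fun h' => hM.1 (top_le_iff.1 (h' ▸ hD ▸ inf_le_left))
    have hNtop : Subgroup.normalizer (D : Set G) ≠ ⊤ := by
      intro h'
      have : D.Normal := Subgroup.normalizer_eq_top_iff.1 h'
      exact (this.eq_bot_or_eq_top).elim h hDtop
    obtain ⟨E, hE, hNE⟩ := (eq_top_or_exists_le_coatom _).resolve_left hNtop
    have key : ∀ A : Subgroup G, IsCoatom A → D < A → A = E := by
      intro A hA hDA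
      have := hn A hA.1
      have hlt : D.subgroupOf A < ⊤ := by
        rw [lt_top_iff_ne_top, Ne, Subgroup.subgroupOf_eq_top]
        exact not_le_of_gt hDA
      obtain ⟨x, hx, hxD⟩ := SetLike.exists_of_lt
        (Group.normalizerCondition_of_isNilpotent (G := A) _ hlt)
      rw [← Subgroup.subgroupOf_normalizer_eq hDA.le] at hx
      have hlt' : D < A ⊓ E := by
        refine lt_of_le_of_ne (le_inf hDA.le (Subgroup.le_normalizer.trans hNE)) ?_
        intro h'
        apply hxD
        rw [Subgroup.mem_subgroupOf, h']
        exact ⟨x.2, hNE hx⟩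
      exact ih (A ⊓ E) hlt' hA hE (ne_bot_of_gt hlt') rfl
    have h1 : D < M := by
      refine lt_of_le_of_ne (hD ▸ inf_le_left) fun h' => hne ?_
      have : M ≤ L := inf_eq_left.1 (hD.trans h')
      exact (hM.le_iff.1 this).resolve_left hL.1 |>.symm
    have h2 : D < L := by
      refine lt_of_le_of_ne (hD ▸ inf_le_right) fun h' => hne ?_
      have : L ≤ M := inf_eq_right.1 (hD.trans h')
      exact (hL.le_iff.1 this).resolve_left hM.1
    exact hne ((key M hM h1).trans (key L hL h2).symm)

theorem IsCoatom.map_conj_eq_of_conj_eq [IsSimpleGroup G]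
    (hn : ∀ H : Subgroup G, H ≠ ⊤ → Group.IsNilpotent H) {M L : Subgroup G} (hM : IsCoatom M)
    (hL : IsCoatom L) {g h x y : G} (hx : x ∈ M) (hy : y ∈ L) (hx1 : x ≠ 1)
    (hxy : g * x * g⁻¹ = h * y * h⁻¹) :
    M.map (MulAut.conj g).toMonoidHom = L.map (MulAut.conj h).toMonoidHom := by
  refine (hM.map_conj g).eq_of_inf_ne_bot hn (hL.map_conj h) fun hbot => hx1 ?_
  have : g * x * g⁻¹ ∈ M.map (MulAut.conj g).toMonoidHom ⊓ L.map (MulAut.conj h).toMonoidHom :=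
    ⟨⟨x, hx, rfl⟩, ⟨y, hy, by simpa using hxy.symm⟩⟩
  rw [hbot, Subgroup.mem_bot] at this
  simpa using this

theorem IsCoatom.conjugates_injective [IsSimpleGroup G]
    (hn : ∀ H : Subgroup G, H ≠ ⊤ → Group.IsNilpotent H) {M : Subgroup G} (hM : IsCoatom M)
    (hbot : M ≠ ⊥) {a b : G ⧸ M} {x y : G} (hx : x ∈ M) (hy : y ∈ M) (hx1 : x ≠ 1)
    (hxy : a.out * x * a.out⁻¹ = b.out * y * b.out⁻¹) : a = b ∧ x = y := by
  have hmap := hM.map_conj_eq_of_conj_eq hn hM hx hy hx1 hxy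
  have hN : Subgroup.normalizer (M : Set G) = M := by
    refine (hM.le_iff.1 Subgroup.le_normalizer).resolve_left fun h' => ?_
    have : M.Normal := Subgroup.normalizer_eq_top_iff.1 h'
    exact (this.eq_bot_or_eq_top).elim hbot hM.1
  have hab : a = b := by
    rw [← QuotientGroup.out_eq' a, ← QuotientGroup.out_eq' b, QuotientGroup.eq]
    refine hN.le (Subgroup.mem_normalizer_iff.2 fun z => ?_)
    have h1 : z ∈ M ↔ b.out * z * b.out⁻¹ ∈ M.map (MulAut.conj b.out).toMonoidHom := by
      simp [Subgroup.mem_map]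
    have h2 : ∀ w, w ∈ M ↔ a.out * w * a.out⁻¹ ∈ M.map (MulAut.conj a.out).toMonoidHom := by
      simp [Subgroup.mem_map]
    rw [h1, h2, ← hmap]
    group
  subst hab
  exact ⟨rfl, by simpa using hxy⟩

theorem Group.isSolvable_of_isSimpleGroup_of_forall_isNilpotent [IsSimpleGroup G]
    (hn : ∀ H : Subgroup G, H ≠ ⊤ → Group.IsNilpotent H) : Group.IsSolvable G := by
  by_contra hs
  have hz : ∀ x : G, Subgroup.zpowers x ≠ ⊤ := by
    intro x hx
    have : IsCyclic G := ⟨x, fun y => Subgroup.mem_zpowers_iff.1 (hx.symm ▸ Subgroup.mem_top y)⟩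
    exact hs inferInstance
  obtain ⟨M, hM, -⟩ := (eq_top_or_exists_le_coatom (⊥ : Subgroup G)).resolve_left bot_ne_top
  obtain ⟨x, hx⟩ := Subgroup.exists_forall_conj_notMem hM.1
  obtain ⟨L, hL, hxL⟩ := (eq_top_or_exists_le_coatom _).resolve_left (hz x)
  have hxL : x ∈ L := hxL (Subgroup.mem_zpowers x)
  have hx1 : x ≠ 1 := by
    rintro rfl
    exact hx 1 (by simp)
  have hMbot : M ≠ ⊥ := by
    rintro rfl
    exact hz x (hM.2 _ (bot_lt_iff_ne_bot.2 (by simpa using hx1)))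
  have hLbot : L ≠ ⊥ := by
    rintro rfl
    exact hx1 (by simpa using hxL)
  let f : ((G ⧸ M) × {z : M // z ≠ 1}) ⊕ ((G ⧸ L) × {z : L // z ≠ 1}) → {z : G // z ≠ 1} :=
    Sum.elim (fun a => ⟨a.1.out * a.2 * a.1.out⁻¹, by simpa using a.2.2⟩)
      (fun a => ⟨a.1.out * a.2 * a.1.out⁻¹, by simpa using a.2.2⟩)
  have hML : ∀ g h : G,
      M.map (MulAut.conj g).toMonoidHom ≠ L.map (MulAut.conj h).toMonoidHom := by
    intro g h hgh
    have : h * x * h⁻¹ ∈ M.map (MulAut.conj g).toMonoidHom := hgh ▸ ⟨x, hxL, rfl⟩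
    obtain ⟨m, hm, hmx⟩ := this
    apply hx (h⁻¹ * g)
    have hmx : g * m * g⁻¹ = h * x * h⁻¹ := by simpa using hmx
    have : (h⁻¹ * g)⁻¹ * x * (h⁻¹ * g) = g⁻¹ * (h * x * h⁻¹) * g := by group
    rw [this, ← hmx]
    simpa [mul_assoc] using hm
  have hf : Function.Injective f := by
    rintro (⟨a, x, hx⟩ | ⟨a, x, hx⟩) (⟨b, y, hy⟩ | ⟨b, y, hy⟩) hxy
    all_goals
      have hxy := congrArg Subtype.val hxy
      simp only [f, Sum.elim_inl, Sum.elim_inr] at hxy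
      have hx' : (x : G) ≠ 1 := by simpa using hx
      have hy' : (y : G) ≠ 1 := by simpa using hy
    · obtain ⟨rfl, h⟩ := hM.conjugates_injective hn hMbot x.2 y.2 hx' hxy
      simp [Subtype.ext h]
    · exact absurd (hM.map_conj_eq_of_conj_eq hn hL x.2 y.2 hx' hxy) (hML _ _)
    · exact absurd (hM.map_conj_eq_of_conj_eq hn hL y.2 x.2 hy' hxy.symm) (hML _ _)
    · obtain ⟨rfl, h⟩ := hL.conjugates_injective hn hLbot x.2 y.2 hx' hxy
      simp [Subtype.ext h]
  have hle := Nat.card_le_card_of_injective f hf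
  have hne : ∀ (K : Type _) [Group K] [Finite K], Nat.card {z : K // z ≠ 1} = Nat.card K - 1 := by
    intro K _ _
    have := Fintype.ofFinite K
    classical
    simp [Nat.card_eq_fintype_card, Fintype.card_subtype_compl]
  rw [Nat.card_sum, Nat.card_prod, Nat.card_prod, hne, hne, hne] at hle
  have h1 := Subgroup.card_eq_card_quotient_mul_card_subgroup M
  have h2 := Subgroup.card_eq_card_quotient_mul_card_subgroup L
  have hM2 := (Subgroup.one_lt_card_iff_ne_bot M).2 hMbot
  have hL2 := (Subgroup.one_lt_card_iff_ne_bot L).2 hLbot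
  have hG : 0 < Nat.card G := Nat.card_pos
  obtain ⟨u, hu⟩ := Nat.exists_eq_add_of_lt hM2
  obtain ⟨v, hv⟩ := Nat.exists_eq_add_of_lt hL2
  rw [hu] at h1 hle
  rw [hv] at h2 hle
  have e1 : 1 + u + 1 - 1 = 1 + u := rfl
  have e2 : 1 + v + 1 - 1 = 1 + v := rfl
  rw [e1, e2] at hle
  have : Nat.card G - 1 + 1 = Nat.card G := Nat.sub_add_cancel hG
  nlinarith [Nat.zero_le (Nat.card (G ⧸ M) * u), Nat.zero_le (Nat.card (G ⧸ L) * v)]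

end MinimalNonnilpotent

/-- A finite group all of whose proper subgroups are nilpotent is solvable. -/
theorem Group.isSolvable_of_forall_isNilpotent {G : Type*} [Group G] [Finite G]
    (hn : ∀ H : Subgroup G, H ≠ ⊤ → Group.IsNilpotent H) : Group.IsSolvable G := by
  obtain ⟨n, hcard⟩ : ∃ n, Nat.card G = n := ⟨_, rfl⟩
  induction n using Nat.strong_induction_on generalizing G with
  | _ n ih =>
    by_cases hs : IsSimpleGroup G
    · exact Group.isSolvable_of_isSimpleGroup_of_forall_isNilpotent hn
    rcases subsingleton_or_nontrivial G with h | h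
    · infer_instance
    obtain ⟨N, hN, hbot, htop⟩ : ∃ N : Subgroup G, N.Normal ∧ N ≠ ⊥ ∧ N ≠ ⊤ := by
      by_contra! h'
      exact hs ⟨fun N hN => or_iff_not_imp_left.2 (h' N hN)⟩
    have hq : Group.IsSolvable (G ⧸ N) := by
      refine ih _ ?_ (fun H hH => ?_) rfl
      · rw [← hcard, Subgroup.card_eq_card_quotient_mul_card_subgroup N]
        exact lt_mul_of_one_lt_right Nat.card_pos ((Subgroup.one_lt_card_iff_ne_bot N).2 hbot)
      · have hsurj := QuotientGroup.mk'_surjective N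
        have : H.comap (QuotientGroup.mk' N) ≠ ⊤ := by
          intro h'
          apply hH
          rw [← Subgroup.map_comap_eq_self_of_surjective hsurj H, h',
            Subgroup.map_top_of_surjective _ hsurj]
        have := hn _ this
        exact Group.nilpotent_of_surjective ((QuotientGroup.mk' N).subgroupComap H)
          (MonoidHom.subgroupComap_surjective_of_surjective _ _ hsurj)
    have := hn N htop
    exact Group.isSolvable_of_ker_le_range N.subtype (QuotientGroup.mk' N) (by simp)

theorem Subgroup.eq_top_of_forall_exists_sylow_le {G : Type*} [Group G] [Finite G]
    {N : Subgroup G}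
    (h : ∀ p : ℕ, p.Prime → ∃ P : Sylow p G, (P : Subgroup G) ≤ N) : N = ⊤ := by
  by_contra hN
  obtain ⟨p, hp, hdvd⟩ := Nat.exists_prime_and_dvd (mt Subgroup.index_eq_one.1 hN)
  have := Fact.mk hp
  obtain ⟨P, hP⟩ := h p hp
  exact P.not_dvd_index (hdvd.trans (Subgroup.index_dvd_of_le hP))

/-- If all proper subgroups of a finite group are nilpotent, every Sylow subgroup is normal or
cyclic. -/
theorem Sylow.normal_or_exists_zpowers_eq {G : Type*} [Group G] [Finite G]
    (hn : ∀ H : Subgroup G, H ≠ ⊤ → Group.IsNilpotent H) {q : ℕ} [hq : Fact q.Prime]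
    (Q : Sylow q G) : (Q : Subgroup G).Normal ∨ ∃ y : G, Subgroup.zpowers y = Q := by
  rcases subsingleton_or_nontrivial G with _ | _
  · exact Or.inl ⟨fun a _ b => by rw [Subsingleton.elim (b * a * b⁻¹) 1]; exact one_mem _⟩
  have := Group.isSolvable_of_forall_isNilpotent hn
  obtain ⟨M, hM, hcM⟩ := (eq_top_or_exists_le_coatom _).resolve_left
    (Group.IsSolvable.commutator_lt_top_of_nontrivial G).ne
  have hMn : M.Normal := Subgroup.Normal.of_commutator_le G hcM
  have hMnil := hn M hM.1
  by_cases hQM : (Q : Subgroup G) ≤ M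
  · exact Or.inl (Q.normal_of_le_of_isNilpotent hMnil hQM)
  obtain ⟨y, hyQ, hyM⟩ := SetLike.not_le_iff_exists.1 hQM
  have hyQ' : Subgroup.zpowers y ≤ Q := (Subgroup.zpowers_le).2 hyQ
  have hsup : M ⊔ Subgroup.zpowers y = ⊤ :=
    hM.2 _ (left_lt_sup.2 fun h => hyM (h (Subgroup.mem_zpowers y)))
  by_cases hyz : Subgroup.zpowers y = Q
  · exact Or.inr ⟨y, hyz⟩
  refine Or.inl (Subgroup.normalizer_eq_top_iff.1
    (Subgroup.eq_top_of_forall_exists_sylow_le fun p hp => ?_))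
  have := Fact.mk hp
  by_cases hpq : p = q
  · subst hpq
    exact ⟨Q, Subgroup.le_normalizer⟩
  obtain ⟨P⟩ : Nonempty (Sylow p G) := inferInstance
  refine ⟨P, ?_⟩
  have hPM : (P : Subgroup G) ≤ M := by
    rw [← Subgroup.relIndex_eq_one]
    obtain ⟨k, hk⟩ := IsPGroup.iff_card.1 P.2
    obtain ⟨l, hl⟩ := IsPGroup.iff_card.1 Q.2
    have h1 : M.relIndex P ∣ p ^ k := hk ▸ Subgroup.relIndex_dvd_card M P
    have h2 : M.relIndex P ∣ q ^ l := by
      refine (Subgroup.relIndex_dvd_index_of_normal M P).trans ?_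
      rw [← Subgroup.relIndex_top_right, ← hsup, sup_comm, Subgroup.relIndex_sup_right, ← hl]
      exact (Subgroup.relIndex_dvd_card _ _).trans (Subgroup.card_dvd_of_le hyQ')
    exact Nat.eq_one_of_dvd_coprimes
      (Nat.Coprime.pow k l ((Nat.coprime_primes hp hq.out).2 hpq)) h1 h2
  have hPn : (P : Subgroup G).Normal := P.normal_of_le_of_isNilpotent hMnil hPM
  have hdisj := IsPGroup.disjoint_of_ne p q hpq _ _ P.2 Q.2
  have hPy : (P : Subgroup G) ⊔ Subgroup.zpowers y ≠ ⊤ := by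
    intro h
    refine hyz (le_antisymm hyQ' fun z hz => ?_)
    obtain ⟨a, ha, b, hb, rfl⟩ := Subgroup.mem_sup_of_normal_left.1 (h.symm ▸ Subgroup.mem_top z)
    have haQ : a ∈ (Q : Subgroup G) :=
      (Subgroup.mul_mem_cancel_right (Q : Subgroup G) (hyQ' hb)).1 hz
    rw [Subgroup.disjoint_def.1 hdisj ha haQ, one_mul]
    exact hb
  have hcomm : ∀ a ∈ P, ∀ z ∈ Q, a * z = z * a := by
    intro a ha z hz
    obtain ⟨m, hm, b, hb, rfl⟩ :=
      Subgroup.mem_sup_of_normal_left.1 (hsup.symm ▸ Subgroup.mem_top z)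
    have hmQ : m ∈ (Q : Subgroup G) :=
      (Subgroup.mul_mem_cancel_right (Q : Subgroup G) (hyQ' hb)).1 hz
    have h1 := IsPGroup.commute_of_isNilpotent_of_le hMnil hpq P.2 Q.2 ha hmQ (hPM ha) hm
    have h2 := IsPGroup.commute_of_isNilpotent_of_le (hn _ hPy) hpq P.2 Q.2 ha (hyQ' hb)
      (Subgroup.mem_sup_left ha) (Subgroup.mem_sup_right hb)
    exact Commute.mul_right h1 h2
  intro a ha
  rw [Subgroup.mem_normalizer_iff]
  have key : ∀ z ∈ Q, a * z * a⁻¹ = z := fun z hz => by rw [hcomm a ha z hz]; simp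
  refine fun z => ⟨fun hz => ?_, fun hz => ?_⟩
  · exact (key z hz).symm ▸ hz
  · have h1 := key _ hz
    have : a * z * a⁻¹ = z := by
      have := congrArg (fun w => a⁻¹ * w * a) h1
      simpa [mul_assoc] using this
    exact this ▸ hz

/-- If a finite group is covered by nilpotent subgroups whose orders are divisible by the order of
a Sylow subgroup, that Sylow subgroup is normal. -/
theorem Sylow.normal_of_cover {G : Type*} [Group G] [Finite G] {q : ℕ} [hq : Fact q.Prime]
    (Q : Sylow q G)
    (hcov : ∀ g : G, ∃ H : Subgroup G, g ∈ H ∧ Group.IsNilpotent H ∧ Nat.card Q ∣ Nat.card H) :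
    (Q : Subgroup G).Normal := by
  rw [← Subgroup.normalizer_eq_top_iff]
  by_contra hN
  obtain ⟨x, hx⟩ := Subgroup.exists_forall_conj_notMem hN
  obtain ⟨H, hxH, hH, hdvd⟩ := hcov x
  obtain ⟨R⟩ : Nonempty (Sylow q H) := inferInstance
  have hR : Nat.card (R.map H.subtype) = q ^ (Nat.card G).factorization q := by
    rw [← Q.card_eq_multiplicity]
    refine Nat.dvd_antisymm ?_ ?_
    · rw [Q.card_eq_multiplicity]
      obtain ⟨k, hk⟩ := IsPGroup.iff_card.1 (R.2.map H.subtype)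
      rw [hk]
      refine pow_dvd_pow q ((hq.out.pow_dvd_iff_le_factorization Nat.card_pos.ne').1 ?_)
      exact hk ▸ Subgroup.card_subgroup_dvd_card _
    · rw [Subgroup.card_map_of_injective H.subtype_injective, Q.card_eq_multiplicity] at *
      exact R.pow_dvd_card_of_pow_dvd_card hdvd
  obtain ⟨g, hg⟩ := MulAction.exists_smul_eq G Q (Sylow.ofCard _ hR)
  have hxR : x • Sylow.ofCard _ hR = Sylow.ofCard _ hR := by
    rw [Sylow.smul_eq_iff_mem_normalizer]
    refine Subgroup.mem_normalizer_iff.2 ?_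
    have hRn : (R : Subgroup H).Normal := inferInstance
    intro z
    constructor
    · rintro ⟨w, hw, rfl⟩
      exact ⟨_, hRn.conj_mem w hw ⟨x, hxH⟩, rfl⟩
    · rintro ⟨w, hw, hwz⟩
      refine ⟨_, hRn.conj_mem w hw ⟨x, hxH⟩⁻¹, ?_⟩
      have : (w : G) = x * z * x⁻¹ := hwz
      simp [this, mul_assoc]
  refine hx g (Sylow.smul_eq_iff_mem_normalizer.1 ?_)
  rw [mul_smul, mul_smul, hg, hxR, ← hg, inv_smul_smul]

/-- A finite group with an `ES`-partition is nilpotent as soon as its proper subgroups are. -/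
theorem IsESPartition.isNilpotent {G : Type*} [Group G] [Finite G]
    (hn : ∀ H : Subgroup G, H ≠ ⊤ → Group.IsNilpotent H) {S : Subgroup G}
    {P : Finset (Subgroup G)} (hP : IsESPartition S P) : Group.IsNilpotent G := by
  obtain ⟨⟨-, hne, hcov, -⟩, hcard⟩ := hP
  have hsyl : ∀ (q : ℕ) (_ : Fact q.Prime) (Q : Sylow q G), (Q : Subgroup G).Normal := by
    intro q _ Q
    obtain h | ⟨y, hy⟩ := Q.normal_or_exists_zpowers_eq hn
    · exact h
    obtain ⟨K, hK, hyK⟩ := hcov y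
    refine Q.normal_of_cover fun g => ?_
    obtain ⟨H, hH, hgH⟩ := hcov g
    refine ⟨H, hgH, hn H (hne H hH), ?_⟩
    rw [hcard H hH K hK]
    exact Subgroup.card_dvd_of_le (hy ▸ (Subgroup.zpowers_le).2 hyK)
  exact ((Group.isNilpotent_of_finite_tfae (G := G)).out 0 3).2 hsyl

theorem IsESPartition.exists_comap {G V : Type*} [Group G] [Finite G] [Group V] {f : G →* V}
    (hf : Function.Surjective f) {S : Subgroup V} {P : Finset (Subgroup V)}
    (hP : IsESPartition S P) :
    ∃ (T : Subgroup G) (R : Finset (Subgroup G)), IsESPartition T R := by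
  classical
  obtain ⟨⟨h2, hne, hcov, hinf⟩, hcard⟩ := hP
  have hinj := Subgroup.comap_injective hf
  have : Finite V := Finite.of_surjective f hf
  have hc : ∀ H : Subgroup V, Nat.card (H.comap f) * Nat.card V = Nat.card H * Nat.card G := by
    intro H
    rw [← H.card_mul_index, ← (H.comap f).card_mul_index, Subgroup.index_comap_of_surjective H hf]
    ring
  refine ⟨S.comap f, P.image (Subgroup.comap f), ⟨?_, ?_, ?_, ?_⟩, ?_⟩
  · rwa [Finset.card_image_of_injective _ hinj]
  · simp only [Finset.forall_mem_image]
    intro H hH h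
    exact hne H hH (hinj (h.trans (Subgroup.comap_top f).symm))
  · intro g
    obtain ⟨H, hH, hg⟩ := hcov (f g)
    exact ⟨_, Finset.mem_image_of_mem _ hH, hg⟩
  · simp only [Finset.forall_mem_image]
    intro H hH K hK hHK
    rw [← Subgroup.comap_inf, hinf H hH K hK fun h => hHK (h ▸ rfl)]
  · simp only [Finset.forall_mem_image]
    intro H hH K hK
    have h1 := hc H
    rw [hcard H hH K hK, ← hc K] at h1
    exact Nat.eq_of_mul_eq_mul_right Nat.card_pos h1

theorem exists_isESPartition_of_card_eq_sq {V : Type*} [Group V] {p : ℕ} (hp : p.Prime)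
    (hV : Nat.card V = p ^ 2) (hcyc : ¬ IsCyclic V) :
    ∃ (S : Subgroup V) (P : Finset (Subgroup V)), IsESPartition S P := by
  classical
  have : Finite V := Nat.finite_of_card_ne_zero (hV ▸ pow_ne_zero 2 hp.ne_zero)
  have := Fintype.ofFinite (Subgroup V)
  have htop : ∀ H : Subgroup V, Nat.card H = p → H ≠ ⊤ := by
    rintro _ h rfl
    rw [Subgroup.card_top, hV] at h
    have := hp.one_lt
    nlinarith
  have hcov1 : ∀ g : V, g ≠ 1 → Nat.card (Subgroup.zpowers g) = p := by
    intro g hg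
    obtain ⟨k, hk, h⟩ := (Nat.dvd_prime_pow hp).1 (hV ▸ orderOf_dvd_natCard g)
    rw [Nat.card_zpowers, h]
    interval_cases k
    · exact absurd (orderOf_eq_one_iff.1 (by simpa using h)) hg
    · simp
    · exact absurd (isCyclic_of_orderOf_eq_card g (h.trans hV.symm)) hcyc
  have : Nontrivial V := by
    rw [← Finite.one_lt_card_iff_nontrivial, hV]
    exact Nat.one_lt_pow two_ne_zero hp.one_lt
  obtain ⟨g₀, hg₀⟩ := exists_ne (1 : V)
  have hcov : ∀ g : V, ∃ H ∈ Finset.univ.filter fun H : Subgroup V => Nat.card H = p, g ∈ H := by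
    intro g
    by_cases hg : g = 1
    · exact ⟨Subgroup.zpowers g₀, by simpa using hcov1 g₀ hg₀, hg ▸ one_mem _⟩
    · exact ⟨_, by simpa using hcov1 g hg, Subgroup.mem_zpowers g⟩
  refine ⟨⊥, Finset.univ.filter fun H => Nat.card H = p, ⟨?_, ?_, hcov, ?_⟩, ?_⟩
  · rw [Nat.succ_le_iff, Finset.one_lt_card]
    have h₀ := hcov1 g₀ hg₀
    obtain ⟨g, hg⟩ : ∃ g, g ∉ Subgroup.zpowers g₀ := by
      by_contra! h
      exact htop _ h₀ (Subgroup.eq_top_iff' _ |>.2 h)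
    obtain ⟨H, hH, hgH⟩ := hcov g
    exact ⟨Subgroup.zpowers g₀, by simpa using h₀, H, hH, fun h => hg (h ▸ hgH)⟩
  · intro H hH
    exact htop H (by simpa using hH)
  · intro H hH K hK hHK
    simp only [Finset.mem_filter, Finset.mem_univ, true_and] at hH hK
    obtain h | h := (Nat.dvd_prime hp).1 (hH ▸ Subgroup.card_dvd_of_le (inf_le_left : H ⊓ K ≤ H))
    · exact Subgroup.card_eq_one.1 h
    · exact absurd ((Subgroup.eq_of_le_of_card_ge inf_le_left (by omega)).symm.trans
        (Subgroup.eq_of_le_of_card_ge inf_le_right (by omega))) hHK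
  · simp +contextual

theorem IsPGroup.index_eq_of_isCoatom {G : Type*} [Group G] [Finite G] {p : ℕ}
    [hp : Fact p.Prime] (hG : IsPGroup p G) {M : Subgroup G} (hM : IsCoatom M) : M.index = p := by
  obtain ⟨n, hn⟩ := IsPGroup.iff_card.1 hG
  obtain ⟨k, hk⟩ := IsPGroup.iff_card.1 (hG.to_subgroup M)
  have hlt : k < n := by
    rw [← Nat.pow_lt_pow_iff_right hp.out.one_lt, ← hn, ← hk]
    exact lt_of_le_of_ne (Subgroup.card_le_card_group M)
      fun h => hM.1 (Subgroup.card_eq_iff_eq_top M |>.1 h)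
  obtain ⟨K, hK, hMK⟩ := Sylow.exists_subgroup_card_pow_succ
    (hn ▸ pow_dvd_pow p (Nat.succ_le_of_lt hlt)) hk
  have hKtop : K = ⊤ := by
    refine (hM.le_iff.1 hMK).resolve_right ?_
    rintro rfl
    rw [hk] at hK
    exact absurd (Nat.pow_right_injective hp.out.two_le hK) (by simp)
  have h := M.card_mul_index
  rw [← Subgroup.card_top (G := G), ← hKtop, hK, hk, pow_succ] at h
  exact Nat.eq_of_mul_eq_mul_left (pow_pos hp.out.pos k) h

theorem IsPGroup.exists_isESPartition {G : Type*} [Group G] [Finite G] {p : ℕ}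
    [hp : Fact p.Prime] (hG : IsPGroup p G) (hcyc : ¬ IsCyclic G) :
    ∃ (S : Subgroup G) (P : Finset (Subgroup G)), IsESPartition S P := by
  have hz : ∀ x : G, Subgroup.zpowers x ≠ ⊤ := fun x hx =>
    hcyc ⟨x, fun y => Subgroup.mem_zpowers_iff.1 (hx.symm ▸ Subgroup.mem_top y)⟩
  obtain ⟨M, hM, -⟩ := (eq_top_or_exists_le_coatom _).resolve_left (hz 1)
  obtain ⟨x, -, hx⟩ := SetLike.exists_of_lt hM.lt_top
  obtain ⟨L, hL, hxL⟩ := (eq_top_or_exists_le_coatom _).resolve_left (hz x)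
  have hML : ¬ L ≤ M := fun h => hx (h (hxL (Subgroup.mem_zpowers x)))
  have := hG.isNilpotent
  have hMn : M.Normal := Subgroup.NormalizerCondition.normal_of_coatom M Group.normalizerCondition_of_isNilpotent hM
  have hLn : L.Normal := Subgroup.NormalizerCondition.normal_of_coatom L Group.normalizerCondition_of_isNilpotent hL
  have hMi := hG.index_eq_of_isCoatom hM
  have hLi := hG.index_eq_of_isCoatom hL
  have hcard : Nat.card (G ⧸ M ⊓ L) = p ^ 2 := by
    rw [← Subgroup.index, ← Subgroup.relIndex_mul_index (inf_le_right : M ⊓ L ≤ L),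
      Subgroup.inf_relIndex_right, hLi, pow_two]
    congr 1
    have hsup : L ⊔ M = ⊤ := by
      rw [sup_comm]
      exact hM.2 _ (left_lt_sup.2 hML)
    rw [← hMi, ← Subgroup.relIndex_top_right, ← hsup, Subgroup.relIndex_sup_right]
  have hexp : ∀ v : G ⧸ M ⊓ L, v ^ p = 1 := by
    intro v
    obtain ⟨g, rfl⟩ := QuotientGroup.mk_surjective v
    rw [← QuotientGroup.mk_pow, QuotientGroup.eq_one_iff]
    exact ⟨hMi ▸ M.pow_index_mem g, hLi ▸ L.pow_index_mem g⟩
  obtain ⟨S, P, hP⟩ := exists_isESPartition_of_card_eq_sq hp.out hcard (fun h => by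
    obtain ⟨v, hv⟩ := h.exists_ofOrder_eq_natCard
    have h1 := orderOf_dvd_of_pow_eq_one (hexp v)
    rw [hv, hcard] at h1
    have := Nat.le_of_dvd hp.out.pos h1
    have := hp.out.one_lt
    nlinarith)
  exact hP.exists_comap (QuotientGroup.mk'_surjective _)

/-- A finite non-cyclic nilpotent group has an `ES`-partition. -/
theorem Group.IsNilpotent.exists_isESPartition {G : Type*} [Group G] [Finite G]
    [hG : Group.IsNilpotent G] (hcyc : ¬ IsCyclic G) :
    ∃ (S : Subgroup G) (P : Finset (Subgroup G)), IsESPartition S P := by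
  obtain ⟨p, hp, Q, hQ⟩ : ∃ p, p.Prime ∧ ∃ Q : Sylow p G, ¬ IsCyclic Q := by
    by_contra! h
    have : IsZGroup G := ⟨h⟩
    exact hcyc inferInstance
  have := Fact.mk hp
  obtain ⟨e⟩ := ((Group.isNilpotent_of_finite_tfae (G := G)).out 0 4).1 hG
  have hdvd : p ∣ Nat.card G := by
    by_contra h
    have hc : Nat.card Q = 1 := by
      rw [Q.card_eq_multiplicity, Nat.factorization_eq_zero_of_not_dvd h, pow_zero]
    have := (Nat.card_eq_one_iff_unique.1 hc).1
    exact hQ inferInstance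
  let i : (Nat.card G).primeFactors := ⟨p, Nat.mem_primeFactors.2 ⟨hp, hdvd, Nat.card_pos.ne'⟩⟩
  let Q' : Sylow (i : ℕ) G := Q
  obtain ⟨S, P, hP⟩ := Q.2.exists_isESPartition hQ
  let f := (Pi.evalMonoidHom (fun P : Sylow (i : ℕ) G => (P : Subgroup G)) Q').comp
    (Pi.evalMonoidHom (fun j : (Nat.card G).primeFactors =>
      ∀ P : Sylow (j : ℕ) G, (P : Subgroup G)) i)
  have hf : Function.Surjective f :=
    (Function.surjective_eval Q').comp (Function.surjective_eval i)
  exact hP.exists_comap (f := f.comp e.symm.toMonoidHom) (hf.comp e.symm.surjective)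

theorem schmidt_of_minimal_non_ESPartition {G : Type*} [Group G] [Finite G]
    (hnc : ¬ IsCyclic G)
    (hG : ∀ (S : Subgroup G) (P : Finset (Subgroup G)), ¬ IsESPartition S P)
    (hsub : ∀ H : Subgroup G, H ≠ ⊤ → ¬ IsCyclic H →
      ∃ (T : Subgroup H) (P : Finset (Subgroup H)), IsESPartition T P) :
    ¬ Group.IsNilpotent G ∧ ∀ H : Subgroup G, H ≠ ⊤ → Group.IsNilpotent H := by
  refine ⟨fun h => ?_, fun H => ?_⟩
  · obtain ⟨S, P, hP⟩ := h.exists_isESPartition hnc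
    exact hG S P hP
  · induction H using WellFoundedLT.induction with
    | ind H ih =>
      intro hH
      by_cases hc : IsCyclic H
      · let := hc.commGroup
        infer_instance
      obtain ⟨T, P, hP⟩ := hsub H hH hc
      refine hP.isNilpotent fun K hK => ?_
      have hlt : K.map H.subtype < H := by
        refine lt_of_le_of_ne (Subgroup.map_subtype_le K) fun h => hK ?_
        rw [← Subgroup.comap_map_eq_self_of_injective H.subtype_injective K, h]
        exact Subgroup.subgroupOf_self H
      have := ih _ hlt fun h => hlt.not_ge (h ▸ le_top)
      let e := K.equivMapOfInjective H.subtype H.subtype_injective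
      exact Group.nilpotent_of_surjective e.symm.toMonoidHom e.symm.surjective
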